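/- Let 𝔤 be a finite-dimensional real semisimple Lie algebra of non-compact type with Iwasawa subalgebra 𝔰 = 𝔞 ⊕ 𝔫 arising from the Cartan involution θ with fixed-point subalgebra 𝔨, and set 𝔪 = Z_𝔨(𝔞) = {X ∈ 𝔨 : [X,H] = 0 for all H ∈ 𝔞}. Then every X ∈ 𝔪 normalizes 𝔰 (so (ad_𝔤 X)|_𝔰 is a derivation of 𝔰), the map X ↦ (ad_𝔤 X)|_𝔰 is an injective Lie algebra homomorphism from 𝔪 into Der(𝔰), and its image is a compact subalgebra of Der(𝔰). -/

import Mathlib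

noncomputable section

variable {g : Type*} [LieRing g] [LieAlgebra ℝ g]

/-- A Cartan involution of a real Lie algebra: an involutive automorphism `θ` such that
`(X, Y) ↦ -κ(X, θ Y)` is positive definite, where `κ` is the Killing form. -/
def IsCartanInvolution (θ : g ≃ₗ⁅ℝ⁆ g) : Prop :=
  (∀ x, θ (θ x) = x) ∧ ∀ x : g, x ≠ 0 → 0 < -(killingForm ℝ g x (θ x))

/-- The restricted root space of a linear functional `l` on the subspace `a`:
`𝔤_l = {x ∈ 𝔤 | [H, x] = l(H) • x for all H ∈ 𝔞}`. -/
def restrictedRootSpace (a : Submodule ℝ g) (l : Module.Dual ℝ a) : Submodule ℝ g where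
  carrier := {x | ∀ h : a, ⁅(h : g), x⁆ = l h • x}
  add_mem' := by
    intro x y hx hy h
    rw [lie_add, hx h, hy h, smul_add]
  zero_mem' := by intro h; simp
  smul_mem' := by
    intro c x hx h
    rw [lie_smul, hx h, smul_comm]

/-- `a` is a maximal abelian subspace of the `(-1)`-eigenspace `𝔭` of `θ`. -/
def IsMaxAbelianInP (θ : g ≃ₗ⁅ℝ⁆ g) (a : Submodule ℝ g) : Prop :=
  (∀ x ∈ a, θ x = -x) ∧ (∀ x ∈ a, ∀ y ∈ a, ⁅x, y⁆ = 0) ∧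
    ∀ a' : Submodule ℝ g, (∀ x ∈ a', θ x = -x) → (∀ x ∈ a', ∀ y ∈ a', ⁅x, y⁆ = 0) →
      a ≤ a' → a' = a

/-- The set of restricted roots of `a`: nonzero functionals with nonzero root space. -/
def restrictedRoots (a : Submodule ℝ g) : Set (Module.Dual ℝ a) :=
  {l | l ≠ 0 ∧ restrictedRootSpace a l ≠ ⊥}

/-- `H₀` is a regular element of `a`: no restricted root vanishes on it. -/
def IsRegularElt (a : Submodule ℝ g) (H₀ : a) : Prop :=
  ∀ l ∈ restrictedRoots a, l H₀ ≠ 0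

/-- The positive restricted roots `Σ⁺` determined by the regular element `H₀`. -/
def posRestrictedRoots (a : Submodule ℝ g) (H₀ : a) : Set (Module.Dual ℝ a) :=
  {l ∈ restrictedRoots a | 0 < l H₀}

/-- The nilpotent Iwasawa part `𝔫 = ⊕_{λ ∈ Σ⁺} 𝔤_λ`. -/
def iwasawaNilpart (a : Submodule ℝ g) (H₀ : a) : Submodule ℝ g :=
  ⨆ l ∈ posRestrictedRoots a H₀, restrictedRootSpace a l

/-- `𝔤` is of non-compact type (relative to the Cartan involution `θ`): no nonzero Lie ideal
is contained in the fixed-point subalgebra `𝔨` of `θ`. -/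
def IsNoncompactType (θ : g ≃ₗ⁅ℝ⁆ g) : Prop :=
  ∀ I : LieIdeal ℝ g, (∀ x ∈ I, θ x = x) → I = ⊥

/-- `s` is an Iwasawa subalgebra of the non-compact type semisimple algebra `g`, i.e.
`s = 𝔞 ⊕ 𝔫` for some Cartan involution `θ`, maximal abelian subspace `𝔞` of `𝔭`, and
choice of positivity (with `𝔤` of non-compact type relative to `θ`). -/
def IsIwasawaSubalgebraNC (s : LieSubalgebra ℝ g) : Prop :=
  ∃ (θ : g ≃ₗ⁅ℝ⁆ g) (a : Submodule ℝ g) (H₀ : a),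
    IsCartanInvolution θ ∧ IsMaxAbelianInP θ a ∧ IsRegularElt a H₀ ∧ IsNoncompactType θ ∧
      (s : Submodule ℝ g) = a ⊔ iwasawaNilpart a H₀

/-- A Lie subalgebra `h` of the derivations of a real Lie algebra `L` is *compact* if there
is an inner product on `L` (a symmetric positive-definite bilinear form) with respect to
which every element of `h` is skew-adjoint. -/
def IsCompactDerSubalgebra {L : Type*} [LieRing L] [LieAlgebra ℝ L]
    (h : LieSubalgebra ℝ (LieDerivation ℝ L L)) : Prop :=
  ∃ B : LinearMap.BilinForm ℝ L, (∀ x y : L, B x y = B y x) ∧ (∀ x : L, x ≠ 0 → 0 < B x x) ∧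
    ∀ D ∈ h, ∀ x y : L, B (D x) y + B x (D y) = 0

/-- The subalgebra `𝔪 = Z_𝔨(𝔞)`: elements fixed by the Cartan involution `θ` (i.e. in `𝔨`)
that commute with every element of `𝔞`. -/
def centralizerM (θ : g ≃ₗ⁅ℝ⁆ g) (a : Submodule ℝ g) : LieSubalgebra ℝ g where
  carrier := {X | θ X = X ∧ ∀ H ∈ a, ⁅X, H⁆ = 0}
  add_mem' := by
    rintro x y ⟨hx1, hx2⟩ ⟨hy1, hy2⟩
    refine ⟨?_, fun H hH => by rw [add_lie, hx2 H hH, hy2 H hH, add_zero]⟩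
    have h : θ (x + y) = θ x + θ y := θ.toLieHom.map_add x y
    rw [h, hx1, hy1]
  zero_mem' := ⟨θ.toLieHom.map_zero, fun H _ => zero_lie H⟩
  smul_mem' := by
    rintro c x ⟨hx1, hx2⟩
    refine ⟨?_, fun H hH => by rw [smul_lie, hx2 H hH, smul_zero]⟩
    have h : θ (c • x) = c • θ x := θ.toLieHom.map_smul c x
    rw [h, hx1]
  lie_mem' := by
    rintro x y ⟨hx1, hx2⟩ ⟨hy1, hy2⟩
    refine ⟨by rw [LieEquiv.map_lie, hx1, hy1], fun H hH => ?_⟩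
    rw [lie_lie, hx2 H hH, hy2 H hH, lie_zero, lie_zero, sub_zero]

/-- The bilinear form `(x, y) ↦ -κ(x, θ y)` attached to an automorphism `θ`. -/
def cartanForm (θ : g ≃ₗ⁅ℝ⁆ g) : LinearMap.BilinForm ℝ g :=
  -(killingForm ℝ g).compl₂ (θ : g →ₗ[ℝ] g)

lemma cartanForm_apply (θ : g ≃ₗ⁅ℝ⁆ g) (x y : g) :
    cartanForm θ x y = -(killingForm ℝ g x (θ y)) := rfl

lemma cartanForm_symm {θ : g ≃ₗ⁅ℝ⁆ g} (hθ : ∀ x, θ (θ x) = x) (x y : g) :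
    cartanForm θ x y = cartanForm θ y x := by
  rw [cartanForm_apply, cartanForm_apply, ← LieAlgebra.killingForm_of_equiv_apply θ x (θ y), hθ,
    LieModule.traceForm_comm]

/-- The adjoint of `ad h` with respect to the form `-κ(·, θ ·)` is `-ad (θ h)`. -/
lemma cartanForm_lie_left {θ : g ≃ₗ⁅ℝ⁆ g} (hθ : ∀ x, θ (θ x) = x) (h x y : g) :
    cartanForm θ ⁅h, x⁆ y = -cartanForm θ x ⁅θ h, y⁆ := by
  rw [cartanForm_apply, cartanForm_apply, LieEquiv.map_lie, hθ,
    LieModule.traceForm_apply_lie_apply']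

/-- The inner product space structure on `g` given by a Cartan involution. -/
abbrev cartanCore {θ : g ≃ₗ⁅ℝ⁆ g} (hθ : IsCartanInvolution θ) : InnerProductSpace.Core ℝ g where
  inner x y := cartanForm θ x y
  conj_inner_symm x y := cartanForm_symm hθ.1 y x
  re_inner_nonneg x := by
    rcases eq_or_ne x 0 with rfl | hx
    · simp
    · exact (hθ.2 x hx).le
  add_left x y z := by simp
  smul_left x y r := by simp
  definite x hx := by
    by_contra h
    exact (hθ.2 x h).ne' hx

/-- A family of commuting operators, symmetric for the form of a Cartan involution, is
simultaneously diagonalizable. -/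
lemma iSup_iInf_eigenspace_eq_top [Module.Finite ℝ g] {θ : g ≃ₗ⁅ℝ⁆ g}
    (hθ : IsCartanInvolution θ) {ι : Type*} (T : ι → Module.End ℝ g)
    (hT : ∀ i x y, cartanForm θ (T i x) y = cartanForm θ x (T i y))
    (hC : ∀ i j, Commute (T i) (T j)) :
    ⨆ χ : ι → ℝ, ⨅ i, Module.End.eigenspace (T i) (χ i) = ⊤ := by
  let := (cartanCore hθ).toNormedAddCommGroup
  let : InnerProductSpace ℝ g := InnerProductSpace.ofCore (cartanCore hθ).toCore
  exact LinearMap.IsSymmetric.iSup_iInf_eq_top_of_commute (fun i x y => hT i x y)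
    fun i j _ => hC i j

/-- Restricted root space decomposition, including the zero root space. -/
lemma iSup_restrictedRootSpace_eq_top [Module.Finite ℝ g] {θ : g ≃ₗ⁅ℝ⁆ g}
    (hθ : IsCartanInvolution θ) {a : Submodule ℝ g} (hp : ∀ x ∈ a, θ x = -x)
    (hab : ∀ x ∈ a, ∀ y ∈ a, ⁅x, y⁆ = 0) :
    ⨆ l : Module.Dual ℝ a, restrictedRootSpace a l = ⊤ := by
  have key := iSup_iInf_eigenspace_eq_top hθ (fun h : a => LieAlgebra.ad ℝ g (h : g))
    (fun h x y => by
      simp only [LieAlgebra.ad_apply]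
      rw [cartanForm_lie_left hθ.1, hp h h.2, neg_lie, map_neg, neg_neg])
    (fun h k => LinearMap.ext fun x => by
      simp only [Module.End.mul_apply, LieAlgebra.ad_apply]
      rw [leibniz_lie, hab h h.2 k k.2, zero_lie, zero_add])
  rw [eq_top_iff, ← key]
  refine iSup_le fun χ x hx => ?_
  have hx' : ∀ h : a, ⁅(h : g), x⁆ = χ h • x := by
    simpa [Submodule.mem_iInf, Module.End.mem_eigenspace_iff] using hx
  rcases eq_or_ne x 0 with rfl | h0
  · exact zero_mem _
  have hinj := smul_left_injective ℝ h0
  let l : Module.Dual ℝ a :=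
    { toFun := χ
      map_add' := fun h k => hinj <| by
        simp only [add_smul, ← hx', Submodule.coe_add, add_lie]
      map_smul' := fun c h => hinj <| by
        simp only [smul_eq_mul, mul_smul, ← hx', Submodule.coe_smul, smul_lie, RingHom.id_apply] }
  exact Submodule.mem_iSup_of_mem l hx'

lemma map_mem_restrictedRootSpace_neg {θ : g ≃ₗ⁅ℝ⁆ g} {a : Submodule ℝ g}
    (hp : ∀ x ∈ a, θ x = -x) {l : Module.Dual ℝ a} {x : g} (hx : x ∈ restrictedRootSpace a l) :
    θ x ∈ restrictedRootSpace a (-l) := fun h => by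
  have h1 : θ ⁅(h : g), x⁆ = l h • θ x := by
    rw [hx h]; exact θ.toLieHom.map_smul _ _
  rw [LieEquiv.map_lie, hp h h.2, neg_lie] at h1
  rw [LinearMap.neg_apply, neg_smul, ← h1, neg_neg]

lemma lie_mem_restrictedRootSpace {θ : g ≃ₗ⁅ℝ⁆ g} {a : Submodule ℝ g} {X : g}
    (hX : X ∈ centralizerM θ a) {l : Module.Dual ℝ a} {x : g}
    (hx : x ∈ restrictedRootSpace a l) : ⁅X, x⁆ ∈ restrictedRootSpace a l := fun h => by
  have h1 : ⁅(h : g), X⁆ = 0 := by rw [← lie_skew, hX.2 h h.2, neg_zero]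
  rw [leibniz_lie, h1, zero_lie, zero_add, hx h, lie_smul]

lemma lie_mem_iwasawaNilpart {θ : g ≃ₗ⁅ℝ⁆ g} {a : Submodule ℝ g} {H₀ : a} {X : g}
    (hX : X ∈ centralizerM θ a) {y : g} (hy : y ∈ iwasawaNilpart a H₀) :
    ⁅X, y⁆ ∈ iwasawaNilpart a H₀ := by
  have : iwasawaNilpart a H₀ ≤ (iwasawaNilpart a H₀).comap (LieAlgebra.ad ℝ g X : g →ₗ[ℝ] g) :=
    iSup₂_le fun l hl x hx => Submodule.mem_iSup_of_mem l
      (Submodule.mem_iSup_of_mem hl (lie_mem_restrictedRootSpace hX hx))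
  exact this hy

/-- An element of `𝔤₀` is the sum of an element of `𝔪` and an element of `𝔞`. -/
lemma exists_add_of_mem_restrictedRootSpace_zero {θ : g ≃ₗ⁅ℝ⁆ g} {a : Submodule ℝ g}
    (hθ : ∀ x, θ (θ x) = x) (ha : IsMaxAbelianInP θ a) {x : g}
    (hx : x ∈ restrictedRootSpace a 0) :
    ∃ m ∈ centralizerM θ a, ∃ h ∈ a, x = m + h := by
  have hθx : θ x ∈ restrictedRootSpace a 0 := by
    simpa using map_mem_restrictedRootSpace_neg ha.1 hx
  have comm : ∀ y ∈ restrictedRootSpace a 0, ∀ h ∈ a, ⁅y, h⁆ = 0 := fun y hy h hh => by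
    rw [← lie_skew, hy ⟨h, hh⟩]; simp
  have hadd : ∀ u v, θ (u + v) = θ u + θ v := θ.toLieHom.map_add
  have hsub : ∀ u v, θ (u - v) = θ u - θ v := θ.toLieHom.map_sub
  have hsmul : ∀ (c : ℝ) u, θ (c • u) = c • θ u := θ.toLieHom.map_smul
  have hm : (2⁻¹ : ℝ) • (x + θ x) ∈ restrictedRootSpace a 0 :=
    Submodule.smul_mem _ _ (add_mem hx hθx)
  have hq : (2⁻¹ : ℝ) • (x - θ x) ∈ restrictedRootSpace a 0 :=
    Submodule.smul_mem _ _ (sub_mem hx hθx)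
  refine ⟨_, ⟨?_, comm _ hm⟩, (2⁻¹ : ℝ) • (x - θ x), ?_, ?_⟩
  · rw [hsmul, hadd, hθ, add_comm]
  · set q := (2⁻¹ : ℝ) • (x - θ x) with hqdef
    have hqp : θ q = -q := by rw [hqdef, hsmul, hsub, hθ, ← smul_neg, neg_sub]
    have hmax := ha.2.2 (a ⊔ Submodule.span ℝ {q}) ?_ ?_ le_sup_left
    · rw [← hmax]
      exact Submodule.mem_sup_right (Submodule.mem_span_singleton_self q)
    · intro y hy
      obtain ⟨h, hh, z, hz, rfl⟩ := Submodule.mem_sup.1 hy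
      obtain ⟨c, rfl⟩ := Submodule.mem_span_singleton.1 hz
      rw [hadd, hsmul, ha.1 h hh, hqp, smul_neg, neg_add]
    · intro y hy y' hy'
      obtain ⟨h, hh, z, hz, rfl⟩ := Submodule.mem_sup.1 hy
      obtain ⟨c, rfl⟩ := Submodule.mem_span_singleton.1 hz
      obtain ⟨h', hh', z', hz', rfl⟩ := Submodule.mem_sup.1 hy'
      obtain ⟨c', rfl⟩ := Submodule.mem_span_singleton.1 hz'
      have h1 : ⁅h, q⁆ = 0 := by rw [← lie_skew, comm q hq h hh, neg_zero]
      simp [ha.2.1 h hh h' hh', comm q hq h' hh', h1]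
  · rw [← smul_add, add_add_sub_cancel, ← two_smul ℝ x, smul_smul]
    norm_num

/-- An element of `𝔪` that commutes with `𝔫` commutes with every restricted root space. -/
lemma lie_eq_zero_of_mem_restrictedRootSpace {θ : g ≃ₗ⁅ℝ⁆ g} {a : Submodule ℝ g} {H₀ : a}
    (hθ : ∀ x, θ (θ x) = x) (hp : ∀ x ∈ a, θ x = -x) (hH₀ : IsRegularElt a H₀) {X : g}
    (hX : θ X = X) (hXn : ∀ y ∈ iwasawaNilpart a H₀, ⁅X, y⁆ = 0) {l : Module.Dual ℝ a}
    (hl : l ≠ 0) {x : g} (hx : x ∈ restrictedRootSpace a l) : ⁅X, x⁆ = 0 := by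
  have pos : ∀ {l : Module.Dual ℝ a} {x : g}, l ≠ 0 → x ∈ restrictedRootSpace a l → 0 < l H₀ →
      ⁅X, x⁆ = 0 := fun {l x} hl hx h => by
    rcases eq_or_ne x 0 with rfl | h0
    · exact lie_zero X
    exact hXn x (Submodule.mem_iSup_of_mem l (Submodule.mem_iSup_of_mem
      ⟨⟨hl, (Submodule.ne_bot_iff _).2 ⟨x, hx, h0⟩⟩, h⟩ hx))
  rcases eq_or_ne x 0 with rfl | h0
  · exact lie_zero X
  rcases (hH₀ l ⟨hl, (Submodule.ne_bot_iff _).2 ⟨x, hx, h0⟩⟩).lt_or_gt with h | h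
  · have h1 := pos (neg_ne_zero.2 hl) (map_mem_restrictedRootSpace_neg hp hx) (by simpa using h)
    have h2 : θ ⁅X, θ x⁆ = θ 0 := congrArg θ h1
    rwa [LieEquiv.map_lie, hX, hθ, show θ 0 = 0 from θ.toLieHom.map_zero] at h2
  · exact pos hl hx h

/-- An element of `𝔪` that commutes with `𝔫` vanishes: such elements form an ideal
contained in `𝔨`. -/
lemma eq_zero_of_lie_iwasawaNilpart_eq_zero [Module.Finite ℝ g] {θ : g ≃ₗ⁅ℝ⁆ g}
    {a : Submodule ℝ g} {H₀ : a} (hθ : IsCartanInvolution θ) (ha : IsMaxAbelianInP θ a)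
    (hH₀ : IsRegularElt a H₀) (hnc : IsNoncompactType θ) {X : g} (hX : X ∈ centralizerM θ a)
    (hXn : ∀ y ∈ iwasawaNilpart a H₀, ⁅X, y⁆ = 0) : X = 0 := by
  let I : LieIdeal ℝ g :=
    { carrier := {Z | Z ∈ centralizerM θ a ∧ ∀ y ∈ iwasawaNilpart a H₀, ⁅Z, y⁆ = 0}
      add_mem' := fun {u v} hu hv => ⟨add_mem hu.1 hv.1, fun y hy => by
        rw [add_lie, hu.2 y hy, hv.2 y hy, add_zero]⟩
      zero_mem' := ⟨zero_mem _, fun y _ => zero_lie y⟩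
      smul_mem' := fun c u hu => ⟨(centralizerM θ a).smul_mem c hu.1, fun y hy => by
        rw [smul_lie, hu.2 y hy, smul_zero]⟩
      lie_mem := fun {x Z} hZ => by
        have hx : x ∈ ⨆ l : Module.Dual ℝ a, restrictedRootSpace a l := by
          rw [iSup_restrictedRootSpace_eq_top hθ ha.1 ha.2.1]; trivial
        change ⁅x, Z⁆ ∈ centralizerM θ a ∧ ∀ y ∈ iwasawaNilpart a H₀, ⁅⁅x, Z⁆, y⁆ = 0
        have of_eq_zero : ∀ u : g, ⁅Z, u⁆ = 0 →
            ⁅u, Z⁆ ∈ centralizerM θ a ∧ ∀ y ∈ iwasawaNilpart a H₀, ⁅⁅u, Z⁆, y⁆ = 0 :=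
          fun u hu => by
            rw [← lie_skew, hu, neg_zero]
            exact ⟨zero_mem _, fun y _ => zero_lie y⟩
        refine Submodule.iSup_induction _
          (motive := fun x => ⁅x, Z⁆ ∈ centralizerM θ a ∧
            ∀ y ∈ iwasawaNilpart a H₀, ⁅⁅x, Z⁆, y⁆ = 0) hx ?_ ?_ ?_
        · intro l x hx
          rcases eq_or_ne l 0 with rfl | hl
          · obtain ⟨m, hm, h, hh, rfl⟩ := exists_add_of_mem_restrictedRootSpace_zero hθ.1 ha hx
            have h1 : ⁅h, Z⁆ = 0 := by rw [← lie_skew, hZ.1.2 h hh, neg_zero]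
            rw [add_lie, h1, add_zero]
            refine ⟨(centralizerM θ a).lie_mem hm hZ.1, fun y hy => ?_⟩
            rw [lie_lie, hZ.2 y hy, hZ.2 _ (lie_mem_iwasawaNilpart hm hy), lie_zero, sub_zero]
          · exact of_eq_zero x
              (lie_eq_zero_of_mem_restrictedRootSpace hθ.1 ha.1 hH₀ hZ.1.1 hZ.2 hl hx)
        · exact of_eq_zero 0 (lie_zero Z)
        · intro u v hu hv
          rw [add_lie]
          exact ⟨add_mem hu.1 hv.1, fun y hy => by
            rw [add_lie, hu.2 y hy, hv.2 y hy, add_zero]⟩ }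
  have hI := hnc I fun x hx => hx.1.1
  have hXI : X ∈ I := ⟨hX, hXn⟩
  rwa [hI, LieSubmodule.mem_bot] at hXI

/-- The restricted adjoint action of a subalgebra `m` normalizing a subalgebra `s`,
as a homomorphism from `m` to the derivations of `s`. -/
def restrictAd (m s : LieSubalgebra ℝ g) (h : ∀ X ∈ m, ∀ y ∈ s, ⁅X, y⁆ ∈ s) :
    m →ₗ⁅ℝ⁆ LieDerivation ℝ s s where
  toFun X :=
    { toFun := fun y => ⟨⁅(X : g), (y : g)⁆, h X X.2 y y.2⟩
      map_add' := fun y z => Subtype.ext (lie_add (X : g) (y : g) (z : g))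
      map_smul' := fun c y => Subtype.ext (lie_smul c (X : g) (y : g))
      leibniz' := fun y z => Subtype.ext <| by
        change ⁅(X : g), ⁅(y : g), (z : g)⁆⁆ =
          ⁅(y : g), ⁅(X : g), (z : g)⁆⁆ - ⁅(z : g), ⁅(X : g), (y : g)⁆⁆
        rw [leibniz_lie, ← lie_skew (z : g)]
        abel }
  map_add' X Y := LieDerivation.ext fun y => Subtype.ext (add_lie (X : g) (Y : g) (y : g))
  map_smul' c X := LieDerivation.ext fun y => Subtype.ext (smul_lie c (X : g) (y : g))
  map_lie' {X Y} := LieDerivation.ext fun y => by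
    rw [LieDerivation.lie_apply]
    exact Subtype.ext (lie_lie (X : g) (Y : g) (y : g))

/-- **`ad(𝔪)` gives a compact subalgebra of derivations of the Iwasawa subalgebra.**
For an Iwasawa subalgebra `s = 𝔞 ⊕ 𝔫` of a finite-dimensional real semisimple Lie algebra of
non-compact type, with `𝔪 = Z_𝔨(𝔞)`: every `X ∈ 𝔪` normalizes `s`, the map
`X ↦ (ad_𝔤 X)|_s` is an injective Lie algebra homomorphism `𝔪 → Der(s)`, and its image is a
compact subalgebra of `Der(s)`. -/
theorem adM_is_compact_derivations
    {g : Type*} [LieRing g] [LieAlgebra ℝ g] [Module.Finite ℝ g] [LieAlgebra.IsKilling ℝ g]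
    (θ : g ≃ₗ⁅ℝ⁆ g) (a : Submodule ℝ g) (H₀ : a)
    (hθ : IsCartanInvolution θ) (ha : IsMaxAbelianInP θ a) (hH₀ : IsRegularElt a H₀)
    (hnc : IsNoncompactType θ)
    (s : LieSubalgebra ℝ g) (hs : (s : Submodule ℝ g) = a ⊔ iwasawaNilpart a H₀) :
    (∀ X ∈ centralizerM θ a, ∀ y ∈ s, ⁅X, y⁆ ∈ s) ∧
    ∃ f : centralizerM θ a →ₗ⁅ℝ⁆ LieDerivation ℝ s s,
      Function.Injective f ∧
      (∀ X : centralizerM θ a, ∀ y : s, ((f X y : s) : g) = ⁅(X : g), (y : g)⁆) ∧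
      IsCompactDerSubalgebra f.range := by
  have hmem : ∀ y, y ∈ s ↔ y ∈ a ⊔ iwasawaNilpart a H₀ := fun y => by
    rw [← hs, LieSubalgebra.mem_toSubmodule]
  have hnorm : ∀ X ∈ centralizerM θ a, ∀ y ∈ s, ⁅X, y⁆ ∈ s := by
    intro X hX y hy
    obtain ⟨h, hh, n, hn, rfl⟩ := Submodule.mem_sup.1 ((hmem y).1 hy)
    rw [hmem, lie_add, hX.2 h hh, zero_add]
    exact Submodule.mem_sup_right (lie_mem_iwasawaNilpart hX hn)
  refine ⟨hnorm, restrictAd _ s hnorm, ?_, fun X y => rfl,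
    (cartanForm θ).compl₁₂ s.subtype s.subtype,
    fun x y => cartanForm_symm hθ.1 (x : g) (y : g), fun x hx => ?_, ?_⟩
  · rw [injective_iff_map_eq_zero]
    intro X hX
    refine Subtype.ext (eq_zero_of_lie_iwasawaNilpart_eq_zero hθ ha hH₀ hnc X.2 fun y hy => ?_)
    have hys : y ∈ s := (hmem y).2 (Submodule.mem_sup_right hy)
    exact congrArg Subtype.val (LieDerivation.congr_fun hX (⟨y, hys⟩ : s))
  · exact hθ.2 (x : g) fun h => hx (Subtype.ext h)
  · rintro D ⟨X, rfl⟩ x y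
    change cartanForm θ ⁅(X : g), (x : g)⁆ (y : g) + cartanForm θ (x : g) ⁅(X : g), (y : g)⁆ = 0
    rw [cartanForm_lie_left hθ.1, X.2.1, neg_add_cancel]
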